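/- Fix real numbers α and β and define Δ(r) := max(0, max(β − r, r − α)) for r ∈ ℝ. Let I be a finite index set, g : I → J a function into a finite index set J, and s : I → ℝ, t : I → ℝ with s i ≥ 0 and t i > 0 for all i. For j ∈ J define v j := Δ( (Σ_{i : g i = j} s i)/(Σ_{i : g i = j} t i) ) if the fiber g⁻¹(j) is nonempty, and v j := 0 otherwise. Then Σ_{j∈J} v j ≤ Σ_{i∈I} Δ(s i / t i). -/

import Mathlib

/-- The proportional violation of a ratio `r` with respect to bounds `α`, `β`. -/
noncomputable def propViol (α β r : ℝ) : ℝ := max 0 (max (β - r) (r - α))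

theorem propViol_nonneg (α β r : ℝ) : 0 ≤ propViol α β r :=
  le_max_left _ _

theorem propViol_le_iff {α β r c : ℝ} :
    propViol α β r ≤ c ↔ 0 ≤ c ∧ β - r ≤ c ∧ r - α ≤ c := by
  simp only [propViol, max_le_iff]

/-- The violation of the aggregate ratio of a nonempty family is at most the sum of the
violations of the individual ratios. -/
theorem propViol_sum_div_sum_le {I : Type*} (α β : ℝ) {F : Finset I} (hF : F.Nonempty)
    (s t : I → ℝ) (ht : ∀ i ∈ F, 0 < t i) :
    propViol α β ((∑ i ∈ F, s i) / (∑ i ∈ F, t i)) ≤ ∑ i ∈ F, propViol α β (s i / t i) := by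
  have hT : 0 < ∑ i ∈ F, t i := Finset.sum_pos ht hF
  have hD : ∀ i ∈ F, propViol α β (s i / t i) ≤ ∑ i ∈ F, propViol α β (s i / t i) :=
    fun i hi => Finset.single_le_sum (f := fun i => propViol α β (s i / t i))
      (fun _ _ => propViol_nonneg α β _) hi
  have h0 : 0 ≤ ∑ i ∈ F, propViol α β (s i / t i) :=
    Finset.sum_nonneg fun _ _ => propViol_nonneg α β _
  generalize ∑ i ∈ F, propViol α β (s i / t i) = D at hD h0 ⊢
  refine propViol_le_iff.2 ⟨h0, ?_, ?_⟩
  · rw [sub_le_comm, le_div_iff₀ hT, Finset.mul_sum]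
    refine Finset.sum_le_sum fun i hi => ?_
    rw [← le_div_iff₀ (ht i hi), sub_le_comm]
    exact (propViol_le_iff.1 (hD i hi)).2.1
  · rw [sub_le_iff_le_add, div_le_iff₀ hT, Finset.mul_sum]
    refine Finset.sum_le_sum fun i hi => ?_
    rw [← div_le_iff₀ (ht i hi), ← sub_le_iff_le_add]
    exact (propViol_le_iff.1 (hD i hi)).2.2

/-- Mergeability of the Group Utilitarian-Sum / Group Egalitarian-Sum objectives:
under a merge map `g : I → J`, the total proportional violation of the merged
clusters (with violation `0` for empty merged clusters) is at most the total
proportional violation of the original clusters. -/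
theorem propViol_sum_merge {I J : Type*} [Fintype I] [Fintype J]
    [DecidableEq J] (α β : ℝ) (g : I → J) (s t : I → ℝ)
    (hs : ∀ i, 0 ≤ s i) (ht : ∀ i, 0 < t i) (v : J → ℝ)
    (hv : ∀ j : J, v j =
      if (Finset.univ.filter (fun i => g i = j)).Nonempty then
        propViol α β ((∑ i ∈ Finset.univ.filter (fun i => g i = j), s i) /
          (∑ i ∈ Finset.univ.filter (fun i => g i = j), t i))
      else 0) :
    ∑ j : J, v j ≤ ∑ i : I, propViol α β (s i / t i) := by
  rw [← Finset.sum_fiberwise Finset.univ g]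
  refine Finset.sum_le_sum fun j _ => ?_
  rw [hv j]
  split_ifs with hF
  · exact propViol_sum_div_sum_le α β hF s t fun i _ => ht i
  · exact Finset.sum_nonneg fun _ _ => propViol_nonneg α β _
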